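/- Let ψ_1,...,ψ_N be unit vectors in ℂ^n with probabilities p_1,...,p_N such that Σ_x p_x |ψ_x⟩⟨ψ_x| = (1/n)·I. Then the optimal success probability P* of distinguishing the states |ψ_x⟩⟨ψ_x| prepared with probabilities p_x satisfies P* ≥ n/N. -/

import Mathlib

open Matrix Finset Real
open scoped ComplexOrder

noncomputable section

/-- A density matrix: positive semidefinite with trace 1. -/
def IsDensityMatrix {m : Type*} [Fintype m] (ρ : Matrix m m ℂ) : Prop :=
  ρ.PosSemidef ∧ ρ.trace = 1

/-- The von Neumann entropy (base 2) of a Hermitian matrix, via its eigenvalues. -/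
def vonNeumannEntropy {m : Type*} [Fintype m] [DecidableEq m]
    (ρ : Matrix m m ℂ) (hρ : ρ.IsHermitian) : ℝ :=
  -∑ i, hρ.eigenvalues i * Real.logb 2 (hρ.eigenvalues i)

/-- The Shannon entropy (base 2) of a probability vector. -/
def shannonEntropy {N : ℕ} (p : Fin N → ℝ) : ℝ :=
  -∑ x, p x * Real.logb 2 (p x)

/-- A POVM with `N` outcomes: positive semidefinite operators summing to the identity. -/
def IsPOVM {N n : ℕ} (M : Fin N → Matrix (Fin n) (Fin n) ℂ) : Prop :=
  (∀ x, (M x).PosSemidef) ∧ ∑ x, M x = 1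

/-- The set of achievable success probabilities for discriminating the states `ρ x`
prepared with probabilities `p x`, over all POVMs with `N` outcomes. -/
def succProbs {N n : ℕ} (p : Fin N → ℝ) (ρ : Fin N → Matrix (Fin n) (Fin n) ℂ) : Set ℝ :=
  {s | ∃ M : Fin N → Matrix (Fin n) (Fin n) ℂ,
    IsPOVM M ∧ s = ∑ x, p x * ((M x * ρ x).trace).re}

/-- The outer product `|ψ⟩⟨ψ|` of a vector, with entries `ψ i * conj (ψ j)`. -/
def outer {n : ℕ} (ψ : Fin n → ℂ) : Matrix (Fin n) (Fin n) ℂ :=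
  Matrix.vecMulVec ψ (star ψ)

theorem trace_mul_outer {n : ℕ} (M : Matrix (Fin n) (Fin n) ℂ) (v : Fin n → ℂ) :
    (M * outer v).trace = star v ⬝ᵥ (M *ᵥ v) := by
  rw [outer, Matrix.mul_vecMulVec, Matrix.trace_vecMulVec, dotProduct_comm]

theorem star_dot_self {n : ℕ} (v : Fin n → ℂ) (hv : ∑ i, ‖v i‖ ^ 2 = 1) :
    star v ⬝ᵥ v = 1 := by
  have h : star v ⬝ᵥ v = ((∑ i, ‖v i‖ ^ 2 : ℝ) : ℂ) := by
    simp only [dotProduct, Pi.star_apply]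
    push_cast
    refine Finset.sum_congr rfl fun i _ => ?_
    exact Complex.conj_mul' (v i)
  rw [h, hv, Complex.ofReal_one]

theorem trace_povm_nonneg {n : ℕ} (M : Matrix (Fin n) (Fin n) ℂ) (hM : M.PosSemidef)
    (v : Fin n → ℂ) : 0 ≤ ((M * outer v).trace).re := by
  rw [trace_mul_outer]
  exact (Complex.le_def.1 (hM.dotProduct_mulVec_nonneg v)).1

theorem trace_povm_le_one {N n : ℕ} (M : Fin N → Matrix (Fin n) (Fin n) ℂ) (hM : IsPOVM M)
    (v : Fin n → ℂ) (hv : ∑ i, ‖v i‖ ^ 2 = 1) (x : Fin N) :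
    ((M x * outer v).trace).re ≤ 1 := by
  have h1 : ∑ y, ((M y * outer v).trace).re = 1 := by
    rw [← Complex.re_sum, ← Matrix.trace_sum, ← Finset.sum_mul, hM.2, trace_mul_outer,
      Matrix.one_mulVec, star_dot_self v hv, Complex.one_re]
  rw [← h1]
  exact Finset.single_le_sum (f := fun y => ((M y * outer v).trace).re)
    (fun y _ => trace_povm_nonneg (M y) (hM.1 y) v) (Finset.mem_univ x)

/-- if `Σ p_x |ψ_x⟩⟨ψ_x| = 𝟙/n` then `P* ≥ n/N`. -/
theorem max_mixed_lower_bound {N n : ℕ}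
    (p : Fin N → ℝ) (hp : ∀ x, 0 ≤ p x) (hp1 : ∑ x, p x = 1)
    (ψ : Fin N → (Fin n → ℂ)) (hψ : ∀ x, ∑ i, ‖ψ x i‖ ^ 2 = 1)
    (hmix : ∑ x, (p x : ℂ) • outer (ψ x) = ((n : ℂ))⁻¹ • (1 : Matrix (Fin n) (Fin n) ℂ)) :
    sSup (succProbs p (fun x => outer (ψ x))) ≥ (n : ℝ) / N := by
  have hN : N ≠ 0 := by
    rintro rfl
    simp at hp1
  have hn : n ≠ 0 := by
    rintro rfl
    simpa using hψ ⟨0, Nat.pos_of_ne_zero hN⟩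
  have hbdd : BddAbove (succProbs p (fun x => outer (ψ x))) := by
    refine ⟨1, ?_⟩
    rintro s ⟨M, hM, rfl⟩
    rw [← hp1]
    exact Finset.sum_le_sum fun x _ =>
      mul_le_of_le_one_right (hp x) (trace_povm_le_one M hM (ψ x) (hψ x) x)
  have hmem : (n : ℝ) * ∑ x, p x ^ 2 ∈ succProbs p (fun x => outer (ψ x)) := by
    refine ⟨fun x => ((n : ℂ) * (p x : ℂ)) • outer (ψ x), ⟨fun x => ?_, ?_⟩, ?_⟩
    · refine (Matrix.posSemidef_vecMulVec_self_star (ψ x)).smul ?_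
      have h : (0 : ℝ) ≤ n * p x := mul_nonneg (Nat.cast_nonneg n) (hp x)
      exact_mod_cast h
    · simp only [mul_smul]
      rw [← Finset.smul_sum, hmix, smul_smul, mul_inv_cancel₀ (Nat.cast_ne_zero.2 hn), one_smul]
    · rw [Finset.mul_sum]
      refine Finset.sum_congr rfl fun x _ => ?_
      have h : ((((n : ℂ) * (p x : ℂ)) • outer (ψ x)) * outer (ψ x)).trace
          = ((n * p x : ℝ) : ℂ) := by
        rw [trace_mul_outer, Matrix.smul_mulVec, outer, Matrix.vecMulVec_mulVec,
          star_dot_self _ (hψ x)]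
        simp [star_dot_self _ (hψ x)]
      simp only [h, Complex.ofReal_re]
      ring
  refine ge_iff_le.2 (le_trans ?_ (le_csSup hbdd hmem))
  have hcs := sq_sum_le_card_mul_sum_sq (s := (Finset.univ : Finset (Fin N))) (f := p)
  rw [hp1] at hcs
  simp only [Finset.card_univ, Fintype.card_fin, one_pow] at hcs
  have hNpos : (0 : ℝ) < N := by exact_mod_cast Nat.pos_of_ne_zero hN
  rw [div_le_iff₀ hNpos]
  nlinarith [mul_le_mul_of_nonneg_left hcs (Nat.cast_nonneg (α := ℝ) n)]
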